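/- For any graph G with m edges, √(s⁺(G)) ≤ (√(8m+1) − 1)/2. -/

import Mathlib

open Finset SimpleGraph

/-- The adjacency matrix of a simple graph (over `ℝ`) is Hermitian. -/
theorem adjHerm {V : Type*} [Fintype V] [DecidableEq V] (G : SimpleGraph V)
    [DecidableRel G.Adj] : (G.adjMatrix ℝ).IsHermitian :=
  by rw [Matrix.IsHermitian, Matrix.conjTranspose_eq_transpose_of_trivial]; exact isSymm_adjMatrix G

open scoped Classical in
/-- The eigenvalues of the adjacency matrix of `G`. -/
noncomputable def adjEig {V : Type*} [Fintype V] [DecidableEq V] (G : SimpleGraph V) : V → ℝ :=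
  (adjHerm G).eigenvalues

/-- `s⁺(G)`: the sum of the squares of the positive adjacency eigenvalues. -/
noncomputable def sPos {V : Type*} [Fintype V] [DecidableEq V] (G : SimpleGraph V) : ℝ :=
  ∑ i, if 0 < adjEig G i then (adjEig G i) ^ 2 else 0

/-- `s⁻(G)`: the sum of the squares of the negative adjacency eigenvalues. -/
noncomputable def sNeg {V : Type*} [Fintype V] [DecidableEq V] (G : SimpleGraph V) : ℝ :=
  ∑ i, if adjEig G i < 0 then (adjEig G i) ^ 2 else 0

/-- The spectral radius (largest adjacency eigenvalue) of `G`. -/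
noncomputable def specRad {V : Type*} [Fintype V] [DecidableEq V] (G : SimpleGraph V) : ℝ :=
  ⨆ i, adjEig G i

open scoped Classical in
/-- The number of edges of `G`. -/
noncomputable def numEdges {V : Type*} [Fintype V] (G : SimpleGraph V) : ℕ :=
  G.edgeFinset.card

open scoped Classical in
/-- The Randić index `R(G) = ∑_{ij ∈ E} 1/√(dᵢ·dⱼ)`, written as half the sum
over ordered adjacent pairs. -/
noncomputable def randic {V : Type*} [Fintype V] (G : SimpleGraph V) : ℝ :=
  (1 / 2) * ∑ i, ∑ j,
    if G.Adj i j then 1 / Real.sqrt ((G.degree i : ℝ) * (G.degree j : ℝ)) else 0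

/-- In a colouring with the least number of colours, any two colour classes are joined by an edge;
hence the number of ordered pairs of distinct colours is at most twice the number of edges. -/
theorem SimpleGraph.exists_coloring_mul_sub_one_le {V : Type*} [Fintype V] [DecidableEq V]
    (G : SimpleGraph V) [DecidableRel G.Adj] :
    ∃ k : ℕ, Nonempty (G.Coloring (Fin k)) ∧ k * k - k ≤ 2 * G.edgeFinset.card := by
  classical
  have hex : ∃ k, G.Colorable k := ⟨_, G.colorable_of_fintype⟩
  obtain ⟨C⟩ := Nat.find_spec hex
  have hmin : ∀ j, G.Colorable j → Nat.find hex ≤ j := fun j hj => Nat.find_min' hex hj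
  generalize Nat.find hex = k at C hmin
  refine ⟨k, ⟨C⟩, ?_⟩
  have hadj : ∀ i j : Fin k, i ≠ j → ∃ u v, G.Adj u v ∧ C u = i ∧ C v = j := by
    intro i j hij
    by_contra! h
    let D : G.Coloring {c : Fin k // c ≠ j} := Coloring.mk
      (fun v => if hv : C v = j then ⟨i, hij⟩ else ⟨C v, hv⟩) (by
        intro u v huv
        have hne := C.valid huv
        by_cases hu : C u = j <;> by_cases hv : C v = j
        · exact absurd (hu.trans hv.symm) hne
        · simpa [hu, hv] using fun e => h v u huv.symm e.symm hu
        · simpa [hu, hv] using fun e => h u v huv e hv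
        · simpa [hu, hv] using hne)
    have hle := hmin _ D.colorable
    rw [Fintype.card_subtype_compl] at hle
    simp only [Fintype.card_fin, Fintype.card_subtype_eq] at hle
    have := i.pos
    omega
  rw [← G.dart_card_eq_twice_card_edges, ← Finset.card_univ]
  calc k * k - k = (Finset.univ : Finset (Fin k)).offDiag.card := by simp [Finset.offDiag_card]
    _ ≤ _ := by
      refine Finset.card_le_card_of_surjOn (fun d : G.Dart => (C d.fst, C d.snd)) ?_
      rintro ⟨i, j⟩ hij
      obtain ⟨u, v, huv, rfl, rfl⟩ := hadj i j (by simpa using hij)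
      exact ⟨⟨(u, v), huv⟩, by simp, rfl⟩

theorem sum_sum_gram_sq {V ι : Type*} [Fintype ι] (b : V → ι → ℝ) (s t : Finset V) :
    ∑ u ∈ s, ∑ v ∈ t, (∑ a, b u a * b v a) ^ 2 =
      ∑ a, ∑ a', (∑ u ∈ s, b u a * b u a') * ∑ v ∈ t, b v a * b v a' := by
  simp_rw [sq, Finset.sum_mul_sum]
  calc _ = ∑ u ∈ s, ∑ a, ∑ a', ∑ v ∈ t, b u a * b v a * (b u a' * b v a') := by
        refine Finset.sum_congr rfl fun u _ => ?_
        rw [Finset.sum_comm]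
        exact Finset.sum_congr rfl fun a _ => Finset.sum_comm
    _ = ∑ a, ∑ a', ∑ u ∈ s, ∑ v ∈ t, b u a * b v a * (b u a' * b v a') := by
        rw [Finset.sum_comm]
        exact Finset.sum_congr rfl fun a _ => Finset.sum_comm
    _ = _ := by
        refine Finset.sum_congr rfl fun a _ => Finset.sum_congr rfl fun a' _ =>
          Finset.sum_congr rfl fun u _ => Finset.sum_congr rfl fun v _ => ?_
        ring

/-- A Gram matrix partitioned into `k × k` blocks has squared Frobenius norm at most `k` times
that of its block diagonal. -/
theorem sum_gram_sq_le_card_mul {V ι κ : Type*} [Fintype V] [Fintype ι] [Fintype κ]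
    [DecidableEq κ] (b : V → ι → ℝ) (C : V → κ) :
    ∑ x : V × V, (∑ a, b x.1 a * b x.2 a) ^ 2 ≤
      Fintype.card κ * ∑ x : V × V with C x.1 = C x.2, (∑ a, b x.1 a * b x.2 a) ^ 2 := by
  have hblock : ∑ x : V × V with C x.1 = C x.2, (∑ a, b x.1 a * b x.2 a) ^ 2 =
      ∑ c, ∑ u with C u = c, ∑ v with C v = c, (∑ a, b u a * b v a) ^ 2 := by
    rw [Finset.sum_filter, Fintype.sum_prod_type,
      ← Finset.sum_fiberwise (s := Finset.univ) (g := C)]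
    refine Finset.sum_congr rfl fun c _ => Finset.sum_congr rfl fun u hu => ?_
    rw [Finset.sum_filter]
    refine Finset.sum_congr rfl fun v _ => ?_
    simp only [Finset.mem_filter, Finset.mem_univ, true_and] at hu
    simp [hu, eq_comm]
  rw [hblock, Fintype.sum_prod_type, sum_sum_gram_sq]
  simp_rw [sum_sum_gram_sq]
  rw [Finset.sum_comm (s := (Finset.univ : Finset κ)), Finset.mul_sum]
  refine Finset.sum_le_sum fun a _ => ?_
  rw [Finset.sum_comm (s := (Finset.univ : Finset κ)), Finset.mul_sum]
  refine Finset.sum_le_sum fun a' _ => ?_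
  rw [← Finset.sum_fiberwise (s := Finset.univ) (g := C) (f := fun u => b u a * b u a')]
  simp_rw [← sq]
  exact sq_sum_le_card_mul_sum_sq

namespace Matrix.IsHermitian

variable {V : Type*} [Fintype V] [DecidableEq V] {A : Matrix V V ℝ} (hA : A.IsHermitian)

/-- The matrix with the same eigenvectors as `A` and prescribed eigenvalues `f`. -/
noncomputable def withEigenvalues (f : V → ℝ) : Matrix V V ℝ :=
  (hA.eigenvectorUnitary : Matrix V V ℝ) * diagonal f * star (hA.eigenvectorUnitary : Matrix V V ℝ)

theorem withEigenvalues_apply (f : V → ℝ) (u v : V) :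
    hA.withEigenvalues f u v = ∑ a, f a *
      ((hA.eigenvectorUnitary : Matrix V V ℝ) u a * (hA.eigenvectorUnitary : Matrix V V ℝ) v a) := by
  rw [withEigenvalues, mul_apply]
  refine Finset.sum_congr rfl fun a _ => ?_
  simp [mul_diagonal, star_apply]
  ring

theorem withEigenvalues_eigenvalues : hA.withEigenvalues hA.eigenvalues = A := by
  conv_rhs => rw [hA.spectral_theorem]
  rfl

theorem withEigenvalues_sub (f g : V → ℝ) :
    hA.withEigenvalues (f - g) = hA.withEigenvalues f - hA.withEigenvalues g := by
  ext u v
  simp [withEigenvalues_apply, sub_mul, Finset.sum_sub_distrib]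

theorem sum_withEigenvalues_mul (f g : V → ℝ) :
    ∑ x : V × V, hA.withEigenvalues f x.1 x.2 * hA.withEigenvalues g x.1 x.2 = ∑ a, f a * g a := by
  have hsymm : ∀ u v, hA.withEigenvalues g u v = hA.withEigenvalues g v u := fun u v => by
    simp only [withEigenvalues_apply, mul_comm]
  have htrace : ∑ x : V × V, hA.withEigenvalues f x.1 x.2 * hA.withEigenvalues g x.1 x.2 =
      (hA.withEigenvalues f * hA.withEigenvalues g).trace := by
    rw [Fintype.sum_prod_type]
    refine Finset.sum_congr rfl fun u _ => ?_
    rw [diag_apply, mul_apply]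
    exact Finset.sum_congr rfl fun v _ => by rw [hsymm u v]
  have hU : star (hA.eigenvectorUnitary : Matrix V V ℝ) * hA.eigenvectorUnitary = 1 :=
    Unitary.coe_star_mul_self _
  rw [htrace, withEigenvalues, withEigenvalues, Matrix.trace_mul_comm, ← Matrix.mul_assoc,
    ← Matrix.mul_assoc, Matrix.trace_mul_comm]
  have : ∀ U W D E : Matrix V V ℝ, W * U = 1 → W * (U * D * W * U * E) = D * E := by
    intro U W D E h
    simp only [Matrix.mul_assoc]
    rw [← Matrix.mul_assoc W U E, h, ← Matrix.mul_assoc W U, h, Matrix.one_mul, Matrix.one_mul]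
  rw [this _ _ _ _ hU, diagonal_mul_diagonal, trace_diagonal]
  exact Finset.sum_congr rfl fun a _ => mul_comm _ _

theorem sum_withEigenvalues_sq_le {κ : Type*} [Fintype κ] [DecidableEq κ] (C : V → κ)
    {f : V → ℝ} (hf : ∀ a, 0 ≤ f a) :
    ∑ x : V × V, hA.withEigenvalues f x.1 x.2 ^ 2 ≤
      Fintype.card κ * ∑ x : V × V with C x.1 = C x.2, hA.withEigenvalues f x.1 x.2 ^ 2 := by
  have hgram : ∀ u v, hA.withEigenvalues f u v =
      ∑ a, (√(f a) * (hA.eigenvectorUnitary : Matrix V V ℝ) u a) *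
        (√(f a) * (hA.eigenvectorUnitary : Matrix V V ℝ) v a) := by
    intro u v
    rw [withEigenvalues_apply]
    refine Finset.sum_congr rfl fun a _ => ?_
    rw [mul_mul_mul_comm, Real.mul_self_sqrt (hf a)]
  simp only [hgram]
  exact sum_gram_sq_le_card_mul
    (fun u a => √(f a) * (hA.eigenvectorUnitary : Matrix V V ℝ) u a) C

/-- Ando–Lin: if the diagonal blocks of a symmetric matrix in a partition into `k` classes vanish,
then the sums of squares `p`, `q` of its positive and negative eigenvalues satisfy
`p + q ≤ k * q`, unless `p = 0`. -/
theorem sum_posPart_sq_eq_zero_or_add_le {κ : Type*} [Fintype κ] [DecidableEq κ] (C : V → κ)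
    (hC : ∀ u v, C u = C v → A u v = 0) :
    ∑ a, (hA.eigenvalues a)⁺ ^ 2 = 0 ∨
      ∑ a, (hA.eigenvalues a)⁺ ^ 2 + ∑ a, (hA.eigenvalues a)⁻ ^ 2 ≤
        Fintype.card κ * ∑ a, (hA.eigenvalues a)⁻ ^ 2 := by
  set f : V → ℝ := fun a => (hA.eigenvalues a)⁺
  set g : V → ℝ := fun a => (hA.eigenvalues a)⁻
  set P := hA.withEigenvalues f
  set N := hA.withEigenvalues g
  have hPN : P - N = A := by
    rw [← withEigenvalues_sub]
    conv_rhs => rw [← hA.withEigenvalues_eigenvalues]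
    congr 1
    ext a
    exact posPart_sub_negPart _
  have hPP : ∑ x : V × V, P x.1 x.2 ^ 2 = ∑ a, f a ^ 2 := by
    simpa only [sq] using hA.sum_withEigenvalues_mul f f
  have hNN : ∑ x : V × V, N x.1 x.2 ^ 2 = ∑ a, g a ^ 2 := by
    simpa only [sq] using hA.sum_withEigenvalues_mul g g
  have hcross : ∑ x : V × V, P x.1 x.2 * N x.1 x.2 = 0 := by
    rw [hA.sum_withEigenvalues_mul f g]
    exact Finset.sum_eq_zero fun a _ => by
      rcases le_total 0 (hA.eigenvalues a) with h | h
      · simp [g, negPart_of_nonneg h]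
      · simp [f, posPart_of_nonpos h]
  have heq : ∀ x : V × V, C x.1 = C x.2 → N x.1 x.2 = P x.1 x.2 := by
    intro x hx
    have h := congrFun (congrFun hPN x.1) x.2
    rw [hC _ _ hx, sub_apply] at h
    linarith
  have hblock : ∑ x : V × V, P x.1 x.2 ^ 2 ≤
      Fintype.card κ * ∑ x : V × V with C x.1 = C x.2, P x.1 x.2 ^ 2 :=
    hA.sum_withEigenvalues_sq_le C fun a => posPart_nonneg _
  have hcauchy := Finset.sum_mul_sq_le_sq_mul_sq
    (Finset.univ.filter fun x : V × V => ¬ C x.1 = C x.2) (fun x => P x.1 x.2) (fun x => N x.1 x.2)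
  have hdN : ∑ x : V × V with C x.1 = C x.2, N x.1 x.2 ^ 2 =
      ∑ x : V × V with C x.1 = C x.2, P x.1 x.2 ^ 2 :=
    Finset.sum_congr rfl fun x hx => by rw [heq x (Finset.mem_filter.1 hx).2]
  have hdPN : ∑ x : V × V with C x.1 = C x.2, P x.1 x.2 * N x.1 x.2 =
      ∑ x : V × V with C x.1 = C x.2, P x.1 x.2 ^ 2 :=
    Finset.sum_congr rfl fun x hx => by rw [heq x (Finset.mem_filter.1 hx).2, sq]
  have hd : 0 ≤ ∑ x : V × V with C x.1 = C x.2, P x.1 x.2 ^ 2 :=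
    Finset.sum_nonneg fun x _ => sq_nonneg _
  have hoffP : 0 ≤ ∑ x : V × V with ¬ C x.1 = C x.2, P x.1 x.2 ^ 2 :=
    Finset.sum_nonneg fun x _ => sq_nonneg _
  have hq : 0 ≤ ∑ a, g a ^ 2 := Finset.sum_nonneg fun x _ => sq_nonneg _
  have hsP := Finset.sum_filter_add_sum_filter_not Finset.univ
    (fun x : V × V => C x.1 = C x.2) (fun x => P x.1 x.2 ^ 2)
  have hsN := Finset.sum_filter_add_sum_filter_not Finset.univ
    (fun x : V × V => C x.1 = C x.2) (fun x => N x.1 x.2 ^ 2)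
  have hsPN := Finset.sum_filter_add_sum_filter_not Finset.univ
    (fun x : V × V => C x.1 = C x.2) (fun x => P x.1 x.2 * N x.1 x.2)
  rw [hPP] at hblock hsP
  rw [hdN, hNN] at hsN
  rw [hdPN, hcross] at hsPN
  set d := ∑ x : V × V with C x.1 = C x.2, P x.1 x.2 ^ 2
  set p := ∑ a, f a ^ 2
  set q := ∑ a, g a ^ 2
  rw [eq_neg_of_add_eq_zero_right hsPN, eq_sub_of_add_eq' hsP, eq_sub_of_add_eq' hsN] at hcauchy
  have hdpq : d * (p + q) ≤ p * q := by linarith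
  rcases (show 0 ≤ p by linarith).eq_or_lt with hp | hp
  · exact Or.inl hp.symm
  · right
    have h1 := mul_le_mul_of_nonneg_right hblock (show 0 ≤ p + q by linarith)
    have h2 := mul_le_mul_of_nonneg_left hdpq (Nat.cast_nonneg (α := ℝ) (Fintype.card κ))
    exact le_of_mul_le_mul_left (by linarith) hp

end Matrix.IsHermitian

theorem sPos_eq_sum_posPart_sq {V : Type*} [Fintype V] [DecidableEq V] (G : SimpleGraph V) :
    sPos G = ∑ a, (adjEig G a)⁺ ^ 2 := by
  refine Finset.sum_congr rfl fun a _ => ?_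
  split_ifs with h
  · rw [posPart_of_nonneg h.le]
  · rw [posPart_of_nonpos (not_lt.1 h)]
    simp

open scoped Classical in
theorem sum_adjEig_sq {V : Type*} [Fintype V] [DecidableEq V] (G : SimpleGraph V) :
    ∑ a, adjEig G a ^ 2 = 2 * numEdges G := by
  have h := (adjHerm G).sum_withEigenvalues_mul (adjHerm G).eigenvalues (adjHerm G).eigenvalues
  rw [Matrix.IsHermitian.withEigenvalues_eigenvalues, Fintype.sum_prod_type] at h
  have hdeg : ∑ v, (G.degree v : ℝ) = 2 * numEdges G := by
    exact_mod_cast G.sum_degrees_eq_twice_card_edges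
  rw [← hdeg]
  simp_rw [sq]
  refine h.symm.trans (Finset.sum_congr rfl fun u _ => ?_)
  simp only [adjMatrix_apply, mul_ite, mul_one, mul_zero, ← ite_and, and_self]
  rw [Finset.sum_boole, ← neighborFinset_eq_filter, card_neighborFinset_eq_degree]

theorem sPos_add_sum_negPart_sq {V : Type*} [Fintype V] [DecidableEq V] (G : SimpleGraph V) :
    sPos G + ∑ a, (adjEig G a)⁻ ^ 2 = 2 * numEdges G := by
  rw [sPos_eq_sum_posPart_sq, ← sum_adjEig_sq, ← Finset.sum_add_distrib]
  refine Finset.sum_congr rfl fun a _ => ?_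
  rcases le_total 0 (adjEig G a) with h | h
  · simp [negPart_of_nonneg h, posPart_of_nonneg h]
  · simp [negPart_of_nonpos h, posPart_of_nonpos h]

theorem sPos_le_sq_sum_negPart_sq {V : Type*} [Fintype V] [DecidableEq V] (G : SimpleGraph V) :
    sPos G ≤ (∑ a, (adjEig G a)⁻ ^ 2) ^ 2 := by
  classical
  obtain ⟨k, ⟨C⟩, hk⟩ := G.exists_coloring_mul_sub_one_le
  have hedge : numEdges G = G.edgeFinset.card := by
    unfold numEdges
    congr!
  have hk' : (k : ℝ) * k - k ≤ 2 * numEdges G := by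
    rw [hedge, sub_le_iff_le_add]
    exact_mod_cast Nat.sub_le_iff_le_add.1 hk
  rw [← sPos_add_sum_negPart_sq] at hk'
  have h : ∑ a, (adjEig G a)⁺ ^ 2 = 0 ∨ ∑ a, (adjEig G a)⁺ ^ 2 + ∑ a, (adjEig G a)⁻ ^ 2 ≤
      Fintype.card (Fin k) * ∑ a, (adjEig G a)⁻ ^ 2 :=
    (adjHerm G).sum_posPart_sq_eq_zero_or_add_le C fun u v huv => by
      rw [adjMatrix_apply, if_neg fun h => C.valid h huv]
  rw [← sPos_eq_sum_posPart_sq, Fintype.card_fin] at h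
  set q := ∑ a, (adjEig G a)⁻ ^ 2
  rcases h with h | h
  · rw [h]
    positivity
  · rcases (Nat.cast_nonneg (α := ℝ) k).eq_or_lt with hk0 | hk0
    · rw [← hk0] at h
      have hq : 0 ≤ q := Finset.sum_nonneg fun a _ => sq_nonneg _
      nlinarith [sq_nonneg q]
    · have hkq : (k : ℝ) - 1 ≤ q := le_of_mul_le_mul_left (by linarith) hk0
      have hq : 0 ≤ q := Finset.sum_nonneg fun a _ => sq_nonneg _
      nlinarith [mul_le_mul_of_nonneg_right hkq hq]

/-- Wu–Elphick: `√(s⁺(G)) ≤ (√(8m+1) - 1)/2`. -/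
theorem sqrt_sPos_le_stanley {n : ℕ} (G : SimpleGraph (Fin n)) :
    Real.sqrt (sPos G) ≤ (Real.sqrt (8 * (numEdges G : ℝ) + 1) - 1) / 2 := by
  have hsum := sPos_add_sum_negPart_sq G
  have hle := sPos_le_sq_sum_negPart_sq G
  set q := ∑ a, (adjEig G a)⁻ ^ 2
  have hq : 0 ≤ q := Finset.sum_nonneg fun a _ => sq_nonneg _
  have hp : 0 ≤ sPos G := by
    rw [sPos_eq_sum_posPart_sq]
    exact Finset.sum_nonneg fun a _ => sq_nonneg _
  have hsqrt : √(sPos G) ≤ q := Real.sqrt_le_iff.2 ⟨hq, hle⟩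
  have hmain : 2 * √(sPos G) + 1 ≤ √(8 * (numEdges G : ℝ) + 1) := by
    refine Real.le_sqrt_of_sq_le ?_
    nlinarith [Real.sq_sqrt hp]
  linarith
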